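/- arXiv:2605.07207 — 3 statements merged into one kernel-verified Lean document; each statement's English description precedes it below -/
import Mathlib

section
/- Let Z be a measurable space, let Y be a finite nonempty set, let P and Q be probability measures on Z, let h be a measurable map assigning to each x ∈ Z a PMF h(·|x) on Y, and let f_X and f_S be measurable maps assigning to each x ∈ Z PMFs f_X(·|x) and f_S(·|x) on Y, with f_S(y|x) > 0 for every x ∈ Z and y ∈ Y. Then |acc_P(f_X) − acc_Q(f_S)| ≤ sqrt((1/2) · E_{x∼P}[KL(f_X(·|x) ‖ f_S(·|x))]) + 2 · TV(P,Q). -/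
open MeasureTheory

open scoped Classical in
/-- Kullback–Leibler divergence between two PMFs (given as real-valued functions)
on a finite set `Y`: `KL(p‖q) = Σ_{y : p y > 0} p y * log (p y / q y)`. -/
noncomputable def klDiv {Y : Type*} [Fintype Y] (p q : Y → ℝ) : ℝ :=
  ∑ y ∈ Finset.univ.filter (fun y => 0 < p y), p y * Real.log (p y / q y)

/-- Total variation distance between two measures on a measurable space:
`TV(P,Q) = sup_{A measurable} |P(A) − Q(A)|`. -/
noncomputable def tvDist {Z : Type*} [MeasurableSpace Z] (P Q : Measure Z) : ℝ :=
  ⨆ A : {A : Set Z // MeasurableSet A}, |(P A.1).toReal - (Q A.1).toReal|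

/-- Soft accuracy of a predictor `f` with respect to target map `h` under
input distribution `D`: `acc_D(f) = E_{x∼D}[Σ_y h(y|x) f(y|x)]`. -/
noncomputable def softAcc {Z Y : Type*} [MeasurableSpace Z] [Fintype Y]
    (D : Measure Z) (h f : Z → Y → ℝ) : ℝ :=
  ∫ x, (∑ y, h x y * f x y) ∂D

/-- Scalar inequality behind Pinsker: a rational lower bound for the logarithm. -/
lemma log_lower_aux (t : ℝ) (ht : 0 < t) :
    (5 * t ^ 2 - 4 * t - 1) / (2 * t ^ 2 + 4 * t) ≤ Real.log t := by
  set F : ℝ → ℝ := fun t => Real.log t - (5 * t ^ 2 - 4 * t - 1) / (2 * t ^ 2 + 4 * t) with hF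
  have hd : ∀ s, 0 < s → HasDerivAt F ((s - 1) ^ 3 / (s ^ 2 * (s + 2) ^ 2)) s := by
    intro s hs
    have h0 : 2 * s ^ 2 + 4 * s ≠ 0 := by positivity
    have hn : HasDerivAt (fun t : ℝ => 5 * t ^ 2 - 4 * t - 1) (10 * s - 4) s := by
      have := ((((hasDerivAt_id s).pow 2).const_mul 5).sub
        ((hasDerivAt_id s).const_mul 4)).sub_const 1
      exact this.congr_deriv (by simp; ring)
    have hm : HasDerivAt (fun t : ℝ => 2 * t ^ 2 + 4 * t) (4 * s + 4) s := by
      have := (((hasDerivAt_id s).pow 2).const_mul 2).add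
        ((hasDerivAt_id s).const_mul 4)
      exact this.congr_deriv (by simp; ring)
    have := (Real.hasDerivAt_log hs.ne').sub (hn.div hm h0)
    refine this.congr_deriv ?_
    have h2 : s + 2 ≠ 0 := by positivity
    have h3 : 2 * s ^ 2 + 4 * s = 2 * s * (s + 2) := by ring
    rw [h3]
    field_simp
    ring
  have hF1 : F 1 = 0 := by simp [hF]; norm_num
  suffices 0 ≤ F t by simpa [hF] using this
  rcases le_total 1 t with h1 | h1
  · have hm : MonotoneOn F (Set.Ici 1) := by
      apply monotoneOn_of_deriv_nonneg (convex_Ici 1)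
      · intro s hs
        exact (hd s (lt_of_lt_of_le one_pos hs)).continuousAt.continuousWithinAt
      · intro s hs
        rw [interior_Ici] at hs
        exact (hd s (lt_trans one_pos hs)).differentiableAt.differentiableWithinAt
      · intro s hs
        rw [interior_Ici] at hs
        have hs' : 1 < s := hs
        rw [(hd s (lt_trans one_pos hs)).deriv]
        have : 0 ≤ s - 1 := by linarith
        positivity
    rw [← hF1]
    exact hm (Set.mem_Ici.2 le_rfl) h1 h1
  · have hm : AntitoneOn F (Set.Ioc 0 1) := by
      apply antitoneOn_of_deriv_nonpos (convex_Ioc 0 1)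
      · intro s hs
        exact (hd s hs.1).continuousAt.continuousWithinAt
      · intro s hs
        rw [interior_Ioc] at hs
        exact (hd s hs.1).differentiableAt.differentiableWithinAt
      · intro s hs
        rw [interior_Ioc] at hs
        rw [(hd s hs.1).deriv]
        have h4 : (s - 1) ^ 3 ≤ 0 := by
          have : 0 ≤ 1 - s := by linarith [hs.2]
          have := pow_nonneg this 3
          nlinarith
        exact div_nonpos_of_nonpos_of_nonneg h4 (by positivity)
    rw [← hF1]
    exact hm ⟨ht, h1⟩ ⟨one_pos, le_rfl⟩ h1

/-- Termwise lower bound for the KL divergence. -/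
lemma kl_term_aux (p q : ℝ) (hp : 0 ≤ p) (hq : 0 < q) :
    3 / 2 * ((p - q) ^ 2 / (p + 2 * q)) + p - q ≤ p * Real.log (p / q) := by
  rcases hp.eq_or_lt with rfl | hp
  · have : 3 / 2 * ((0 - q) ^ 2 / (0 + 2 * q)) + 0 - q = - q / 4 := by
      field_simp; ring
    rw [this]; simp; linarith
  · have := mul_le_mul_of_nonneg_left (log_lower_aux (p / q) (by positivity)) hp.le
    refine le_trans (le_of_eq ?_) this
    have h2 : p + 2 * q ≠ 0 := by positivity
    have h3 : 2 * (p / q) ^ 2 + 4 * (p / q) = 2 * p * (p + 2 * q) / q ^ 2 := by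
      field_simp; ring
    rw [h3]
    field_simp
    ring

lemma klDiv_eq_sum {Y : Type*} [Fintype Y] (p q : Y → ℝ) (hp : ∀ y, 0 ≤ p y) :
    klDiv p q = ∑ y, p y * Real.log (p y / q y) := by
  classical
  unfold klDiv
  apply Finset.sum_subset (Finset.filter_subset _ _)
  intro y _ hy
  have : p y = 0 := by
    refine le_antisymm ?_ (hp y)
    simpa using hy
  simp [this]

/-- Pinsker's inequality, in the form needed. -/
lemma pinsker_aux {Y : Type*} [Fintype Y] (h p q : Y → ℝ)
    (hh0 : ∀ y, 0 ≤ h y) (hh1 : ∀ y, h y ≤ 1)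
    (hp : ∀ y, 0 ≤ p y) (hps : ∑ y, p y = 1)
    (hq : ∀ y, 0 < q y) (hqs : ∑ y, q y = 1) :
    (∑ y, h y * p y - ∑ y, h y * q y) ^ 2 ≤ 1 / 2 * klDiv p q := by
  have hkl : 3 / 2 * ∑ y, (p y - q y) ^ 2 / (p y + 2 * q y) ≤ klDiv p q := by
    rw [klDiv_eq_sum p q hp]
    have := Finset.sum_le_sum (s := Finset.univ)
      (fun y _ => kl_term_aux (p y) (q y) (hp y) (hq y))
    rw [Finset.sum_sub_distrib, Finset.sum_add_distrib, hps, hqs, ← Finset.mul_sum] at this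
    linarith
  have hpos : ∀ y, 0 < p y + 2 * q y := fun y => by linarith [hp y, hq y]
  have hcs : (∑ y, (h y - 1 / 2) * (p y - q y)) ^ 2 ≤
      (∑ y, (p y - q y) ^ 2 / (p y + 2 * q y)) *
        ∑ y, (h y - 1 / 2) ^ 2 * (p y + 2 * q y) := by
    apply Finset.sum_sq_le_sum_mul_sum_of_sq_le_mul
    · intro y _; have := hpos y; positivity
    · intro y _; have := hpos y; positivity
    · intro y _; have := (hpos y).ne'; apply le_of_eq; field_simp
  have h34 : ∑ y, (h y - 1 / 2) ^ 2 * (p y + 2 * q y) ≤ 3 / 4 := by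
    have : ∑ y, (h y - 1 / 2) ^ 2 * (p y + 2 * q y) ≤ ∑ y, 1 / 4 * (p y + 2 * q y) := by
      apply Finset.sum_le_sum
      intro y _
      apply mul_le_mul_of_nonneg_right _ (hpos y).le
      nlinarith [hh0 y, hh1 y]
    rw [← Finset.mul_sum, Finset.sum_add_distrib, ← Finset.mul_sum, hps, hqs] at this
    linarith
  have heq : ∑ y, (h y - 1 / 2) * (p y - q y) = ∑ y, h y * p y - ∑ y, h y * q y := by
    have : ∀ y, (h y - 1 / 2) * (p y - q y) =
      (h y * p y - h y * q y) - 1 / 2 * (p y - q y) := fun y => by ring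
    simp only [this]
    rw [Finset.sum_sub_distrib, ← Finset.mul_sum, Finset.sum_sub_distrib,
      Finset.sum_sub_distrib, hps, hqs]
    ring
  rw [← heq]
  have hS : 0 ≤ ∑ y, (p y - q y) ^ 2 / (p y + 2 * q y) :=
    Finset.sum_nonneg fun y _ => by have := hpos y; positivity
  have := mul_le_mul_of_nonneg_left h34 hS
  linarith

lemma tv_set_aux {Z : Type*} [MeasurableSpace Z] (P Q : Measure Z)
    [IsProbabilityMeasure P] [IsProbabilityMeasure Q] (A : Set Z) (hA : MeasurableSet A) :
    |P.real A - Q.real A| ≤ tvDist P Q := by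
  have hb : BddAbove (Set.range fun A : {A : Set Z // MeasurableSet A} =>
      |(P A.1).toReal - (Q A.1).toReal|) := by
    refine ⟨1, ?_⟩
    rintro _ ⟨B, rfl⟩
    have h1 : P.real B.1 ≤ 1 := measureReal_le_one
    have h2 : Q.real B.1 ≤ 1 := measureReal_le_one
    have h3 : 0 ≤ P.real B.1 := measureReal_nonneg
    have h4 : 0 ≤ Q.real B.1 := measureReal_nonneg
    change |P.real B.1 - Q.real B.1| ≤ 1
    rw [abs_le]; constructor <;> linarith
  exact le_ciSup hb ⟨A, hA⟩

lemma tv_integral_aux {Z : Type*} [MeasurableSpace Z] (P Q : Measure Z)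
    [IsProbabilityMeasure P] [IsProbabilityMeasure Q] (g : Z → ℝ) (hg : Measurable g)
    (h0 : ∀ x, 0 ≤ g x) (h1 : ∀ x, g x ≤ 1) :
    |∫ x, g x ∂P - ∫ x, g x ∂Q| ≤ tvDist P Q := by
  have hi : ∀ (μ : Measure Z) [IsProbabilityMeasure μ], Integrable g μ := fun μ _ =>
    Integrable.of_bound hg.aestronglyMeasurable 1
      (Filter.Eventually.of_forall fun x => by rw [Real.norm_of_nonneg (h0 x)]; exact h1 x)
  have hint : ∀ (μ : Measure Z) [IsProbabilityMeasure μ],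
      IntegrableOn (fun t => μ.real {a | t ≤ g a}) (Set.Ioc 0 1) := by
    intro μ _
    have ha : Antitone fun t => μ.real {a | t ≤ g a} := fun s t hst =>
      measureReal_mono (fun a (ha : t ≤ g a) => le_trans hst ha)
    exact Integrable.of_bound ha.measurable.aestronglyMeasurable 1
      (Filter.Eventually.of_forall fun x => by
        rw [Real.norm_of_nonneg measureReal_nonneg]; exact measureReal_le_one)
  have e : ∀ (μ : Measure Z) [IsProbabilityMeasure μ],
      ∫ x, g x ∂μ = ∫ t in Set.Ioc 0 1, μ.real {a | t ≤ g a} := fun μ _ =>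
    (hi μ).integral_eq_integral_Ioc_meas_le (Filter.Eventually.of_forall h0)
      (Filter.Eventually.of_forall h1)
  rw [e P, e Q, ← integral_sub (hint P) (hint Q), ← Real.norm_eq_abs]
  have := norm_setIntegral_le_of_norm_le_const (μ := volume) (s := Set.Ioc (0:ℝ) 1)
    (f := fun t => P.real {a | t ≤ g a} - Q.real {a | t ≤ g a}) (C := tvDist P Q)
    (by simp) (fun t _ => tv_set_aux P Q _ (measurableSet_le measurable_const hg))
  simpa using this

/-- KL-divergence bound of the cross-domain soft-accuracy gap:
`|acc_P(f_X) − acc_Q(f_S)| ≤ sqrt((1/2)·E_{x∼P}[KL(f_X(·|x)‖f_S(·|x))]) + 2·TV(P,Q)`. -/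
theorem cross_domain_accuracy_gap_bound
    {Z Y : Type*} [MeasurableSpace Z] [Fintype Y] [Nonempty Y]
    (P Q : Measure Z) [IsProbabilityMeasure P] [IsProbabilityMeasure Q]
    (h fX fS : Z → Y → ℝ)
    (hh_meas : ∀ y, Measurable fun x => h x y)
    (hfX_meas : ∀ y, Measurable fun x => fX x y)
    (hfS_meas : ∀ y, Measurable fun x => fS x y)
    (hh_nonneg : ∀ x y, 0 ≤ h x y) (hh_sum : ∀ x, ∑ y, h x y = 1)
    (hfX_nonneg : ∀ x y, 0 ≤ fX x y) (hfX_sum : ∀ x, ∑ y, fX x y = 1)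
    (hfS_nonneg : ∀ x y, 0 ≤ fS x y) (hfS_sum : ∀ x, ∑ y, fS x y = 1)
    (hfS_pos : ∀ x y, 0 < fS x y)
    (hKL_int : Integrable (fun x => klDiv (fX x) (fS x)) P) :
    |softAcc P h fX - softAcc Q h fS| ≤
      Real.sqrt ((1 / 2) * ∫ x, klDiv (fX x) (fS x) ∂P) + 2 * tvDist P Q := by
  have hh1 : ∀ x y, h x y ≤ 1 := fun x y => by
    rw [← hh_sum x]
    exact Finset.single_le_sum (fun i _ => hh_nonneg x i) (Finset.mem_univ y)
  have hacc : ∀ f : Z → Y → ℝ, (∀ y, Measurable fun x => f x y) → (∀ x y, 0 ≤ f x y) →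
      (∀ x, ∑ y, f x y = 1) → Measurable (fun x => ∑ y, h x y * f x y) ∧
      (∀ x, 0 ≤ ∑ y, h x y * f x y) ∧ (∀ x, ∑ y, h x y * f x y ≤ 1) := by
    intro f hm h0 h1
    refine ⟨Finset.measurable_sum _ fun y _ => (hh_meas y).mul (hm y),
      fun x => Finset.sum_nonneg fun y _ => mul_nonneg (hh_nonneg x y) (h0 x y), fun x => ?_⟩
    rw [← h1 x]
    exact Finset.sum_le_sum fun y _ => mul_le_of_le_one_left (h0 x y) (hh1 x y)
  obtain ⟨mX, X0, X1⟩ := hacc fX hfX_meas hfX_nonneg hfX_sum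
  obtain ⟨mS, S0, S1⟩ := hacc fS hfS_meas hfS_nonneg hfS_sum
  have iX : Integrable (fun x => ∑ y, h x y * fX x y) P :=
    Integrable.of_bound mX.aestronglyMeasurable 1
      (Filter.Eventually.of_forall fun x => by rw [Real.norm_of_nonneg (X0 x)]; exact X1 x)
  have iS : Integrable (fun x => ∑ y, h x y * fS x y) P :=
    Integrable.of_bound mS.aestronglyMeasurable 1
      (Filter.Eventually.of_forall fun x => by rw [Real.norm_of_nonneg (S0 x)]; exact S1 x)
  have hTV : |softAcc P h fS - softAcc Q h fS| ≤ tvDist P Q :=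
    tv_integral_aux P Q _ mS S0 S1
  have hTV0 : 0 ≤ tvDist P Q := le_trans (abs_nonneg _) hTV
  have hPin : |softAcc P h fX - softAcc P h fS| ≤
      Real.sqrt ((1 / 2) * ∫ x, klDiv (fX x) (fS x) ∂P) := by
    apply Real.abs_le_sqrt
    set c := softAcc P h fX - softAcc P h fS with hc
    have hci : ∫ x, (∑ y, h x y * fX x y - ∑ y, h x y * fS x y) ∂P = c :=
      integral_sub iX iS
    have iD : Integrable (fun x => ∑ y, h x y * fX x y - ∑ y, h x y * fS x y) P := iX.sub iS
    have hle : ∫ x, (2 * c * (∑ y, h x y * fX x y - ∑ y, h x y * fS x y) - c ^ 2) ∂P ≤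
        ∫ x, 1 / 2 * klDiv (fX x) (fS x) ∂P := by
      apply integral_mono ((iD.const_mul _).sub (integrable_const _))
        (hKL_int.const_mul _)
      intro x
      have := pinsker_aux (h x) (fX x) (fS x) (hh_nonneg x) (hh1 x) (hfX_nonneg x)
        (hfX_sum x) (hfS_pos x) (hfS_sum x)
      refine le_trans ?_ this
      simp only [Pi.sub_apply]
      nlinarith [sq_nonneg ((∑ y, h x y * fX x y - ∑ y, h x y * fS x y) - c)]
    rw [integral_sub (iD.const_mul _) (integrable_const _), integral_const_mul,
      integral_const_mul] at hle
    rw [hci] at hle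
    simp only [integral_const, probReal_univ, one_smul] at hle
    nlinarith
  have := abs_sub_le (softAcc P h fX) (softAcc P h fS) (softAcc Q h fS)
  linarith
end

section
/- Let Z be a measurable space, let Y be a finite nonempty set, let P be a probability measure on Z, let h be a measurable map assigning to each x ∈ Z a PMF h(·|x) on Y, and let f_X and f_S be measurable maps assigning to each x ∈ Z PMFs f_X(·|x) and f_S(·|x) on Y, with f_S(y|x) > 0 for every x ∈ Z and y ∈ Y. Then the in-domain soft accuracy gap satisfies |acc_P(f_X) − acc_P(f_S)| ≤ sqrt((1/2) · E_{x∼P}[KL(f_X(·|x) ‖ f_S(·|x))]). -/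
open MeasureTheory

lemma aux_hasDeriv (t : ℝ) (ht : 0 < t) :
    HasDerivAt (fun t : ℝ => Real.log t - (5*t^2-4*t-1)/(2*t^2+4*t))
      ((t-1)^3/(t^2*(t+2)^2)) t := by
  have hD : 2*t^2+4*t ≠ 0 := by positivity
  have h1 : HasDerivAt (fun t : ℝ => 5*t^2-4*t-1) (10*t-4) t := by
    have := (((hasDerivAt_pow 2 t).const_mul 5).sub ((hasDerivAt_id t).const_mul 4)).sub_const 1
    refine HasDerivAt.congr_deriv this ?_
    norm_num
    try ring
  have h2 : HasDerivAt (fun t : ℝ => 2*t^2+4*t) (4*t+4) t := by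
    have := ((hasDerivAt_pow 2 t).const_mul 2).add ((hasDerivAt_id t).const_mul 4)
    refine HasDerivAt.congr_deriv this ?_
    norm_num
    try ring
  have := (Real.hasDerivAt_log ht.ne').sub (h1.div h2 hD)
  refine HasDerivAt.congr_deriv this ?_
  symm
  have : t + 2 ≠ 0 := by positivity
  have e : 2*t^2+4*t = 2*t*(t+2) := by ring
  rw [e]
  field_simp
  ring

lemma aux_log (t : ℝ) (ht : 0 < t) :
    (5*t^2-4*t-1)/(2*t^2+4*t) ≤ Real.log t := by
  have key : (fun t : ℝ => Real.log t - (5*t^2-4*t-1)/(2*t^2+4*t)) 1 ≤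
      (fun t : ℝ => Real.log t - (5*t^2-4*t-1)/(2*t^2+4*t)) t := by
    rcases le_total t 1 with h | h
    · refine antitoneOn_of_deriv_nonpos (f := fun t : ℝ => Real.log t - (5*t^2-4*t-1)/(2*t^2+4*t)) (convex_Icc t 1) ?_ ?_ ?_ ⟨le_rfl, h⟩ ⟨h, le_rfl⟩ h
      · intro x hx
        exact (aux_hasDeriv x (ht.trans_le hx.1)).continuousAt.continuousWithinAt
      · intro x hx
        rw [interior_Icc] at hx
        exact (aux_hasDeriv x (ht.trans hx.1)).differentiableAt.differentiableWithinAt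
      · intro x hx
        rw [interior_Icc] at hx
        rw [(aux_hasDeriv x (ht.trans hx.1)).deriv]
        apply div_nonpos_of_nonpos_of_nonneg _ (by positivity)
        have : x - 1 ≤ 0 := by linarith [hx.2]
        exact Odd.pow_nonpos (by decide) this
    · refine monotoneOn_of_deriv_nonneg (f := fun t : ℝ => Real.log t - (5*t^2-4*t-1)/(2*t^2+4*t)) (convex_Icc 1 t) ?_ ?_ ?_ ⟨le_rfl, h⟩ ⟨h, le_rfl⟩ h
      · intro x hx
        exact (aux_hasDeriv x (one_pos.trans_le hx.1)).continuousAt.continuousWithinAt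
      · intro x hx
        rw [interior_Icc] at hx
        exact (aux_hasDeriv x (one_pos.trans hx.1)).differentiableAt.differentiableWithinAt
      · intro x hx
        rw [interior_Icc] at hx
        rw [(aux_hasDeriv x (one_pos.trans hx.1)).deriv]
        have : 0 ≤ x - 1 := by linarith [hx.1]
        positivity
  norm_num at key
  exact key

lemma aux_term (p q a m : ℝ) (hp : 0 ≤ p) (hq : 0 < q) (ha0 : 0 ≤ a) (ha1 : a ≤ 1) :
    4*m*(a-1/2)*(p-q) - m^2*(2*p+4*q)/3 + (p-q) ≤ p * Real.log (p/q) := by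
  have hw : 0 < 2*p+4*q := by positivity
  have h1 : 3*(p-q)^2/(2*p+4*q) + (p-q) ≤ p * Real.log (p/q) := by
    rcases hp.eq_or_lt with rfl | hp
    · simp only [zero_mul]
      rw [← le_neg_iff_add_nonpos_right, div_le_iff₀ hw]
      nlinarith [sq_nonneg q]
    · have := mul_le_mul_of_nonneg_left (aux_log (p/q) (by positivity)) hp.le
      refine le_trans (le_of_eq ?_) this
      have e : 2*(p/q)^2+4*(p/q) = 2*p*(p+2*q)/q^2 := by field_simp; ring
      have e2 : 2*p+4*q = 2*(p+2*q) := by ring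
      have : p + 2*q ≠ 0 := by positivity
      rw [e, e2]
      field_simp
      ring
  have h2 : 4*m*(a-1/2)*(p-q) - m^2*(2*p+4*q)/3 ≤ 3*(p-q)^2/(2*p+4*q) := by
    rw [le_div_iff₀ hw]
    have hc : (2*(a-1/2))^2 ≤ 1 := by nlinarith
    have h3 : 0 ≤ (m*(2*p+4*q))^2 * (1 - (2*(a-1/2))^2) :=
      mul_nonneg (sq_nonneg _) (by linarith)
    nlinarith [sq_nonneg (3*(p-q) - m*(2*(a-1/2))*(2*p+4*q))]
  linarith

lemma aux_kl {Y : Type*} [Fintype Y] (h p q : Y → ℝ) (m : ℝ)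
    (h0 : ∀ y, 0 ≤ h y) (hs : ∑ y, h y = 1) (p0 : ∀ y, 0 ≤ p y) (ps : ∑ y, p y = 1)
    (q0 : ∀ y, 0 < q y) (qs : ∑ y, q y = 1) :
    4*m*(∑ y, h y * p y - ∑ y, h y * q y) - 2*m^2 ≤ klDiv p q := by
  have h1 : ∀ y, h y ≤ 1 := fun y => hs ▸
    Finset.single_le_sum (fun i _ => h0 i) (Finset.mem_univ y)
  have e : klDiv p q = ∑ y, p y * Real.log (p y / q y) := by
    unfold klDiv
    apply Finset.sum_subset (Finset.filter_subset _ _)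
    intro y _ hy
    have : p y = 0 := by
      apply le_antisymm _ (p0 y)
      simpa using hy
    simp [this]
  rw [e]
  refine le_trans (le_of_eq ?_) (Finset.sum_le_sum fun y _ =>
    aux_term (p y) (q y) (h y) m (p0 y) (q0 y) (h0 y) (h1 y))
  have : ∀ y, 4*m*(h y-1/2)*(p y-q y) - m^2*(2*p y+4*q y)/3 + (p y-q y)
      = 4*m*(h y * p y) - 4*m*(h y * q y) + (-2*m - 2*m^2/3+1) * p y
        + (2*m - 4*m^2/3 - 1) * q y := fun y => by ring
  simp only [this, Finset.sum_add_distrib, Finset.sum_sub_distrib, ← Finset.mul_sum, ps, qs]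
  ring

lemma aux_int {Z Y : Type*} [MeasurableSpace Z] [Fintype Y]
    (P : Measure Z) [IsProbabilityMeasure P] (h f : Z → Y → ℝ)
    (hm : ∀ y, Measurable fun x => h x y) (fm : ∀ y, Measurable fun x => f x y)
    (h0 : ∀ x y, 0 ≤ h x y) (hs : ∀ x, ∑ y, h x y = 1)
    (f0 : ∀ x y, 0 ≤ f x y) (fs : ∀ x, ∑ y, f x y = 1) :
    Integrable (fun x => ∑ y, h x y * f x y) P := by
  refine integrable_finsetSum _ fun y _ => ?_
  refine Integrable.of_bound ((hm y).mul (fm y)).aestronglyMeasurable 1 (.of_forall fun x => ?_)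
  have h1 : h x y ≤ 1 := hs x ▸ Finset.single_le_sum (fun i _ => h0 x i) (Finset.mem_univ y)
  have f1 : f x y ≤ 1 := fs x ▸ Finset.single_le_sum (fun i _ => f0 x i) (Finset.mem_univ y)
  rw [Real.norm_of_nonneg (mul_nonneg (h0 x y) (f0 x y))]
  exact mul_le_one₀ h1 (f0 x y) f1

/-- In-domain soft-accuracy gap bound:
`|acc_P(f_X) − acc_P(f_S)| ≤ sqrt((1/2)·E_{x∼P}[KL(f_X(·|x)‖f_S(·|x))])`. -/
theorem in_domain_accuracy_gap_bound
    {Z Y : Type*} [MeasurableSpace Z] [Fintype Y] [Nonempty Y]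
    (P : Measure Z) [IsProbabilityMeasure P]
    (h fX fS : Z → Y → ℝ)
    (hh_meas : ∀ y, Measurable fun x => h x y)
    (hfX_meas : ∀ y, Measurable fun x => fX x y)
    (hfS_meas : ∀ y, Measurable fun x => fS x y)
    (hh_nonneg : ∀ x y, 0 ≤ h x y) (hh_sum : ∀ x, ∑ y, h x y = 1)
    (hfX_nonneg : ∀ x y, 0 ≤ fX x y) (hfX_sum : ∀ x, ∑ y, fX x y = 1)
    (hfS_nonneg : ∀ x y, 0 ≤ fS x y) (hfS_sum : ∀ x, ∑ y, fS x y = 1)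
    (hfS_pos : ∀ x y, 0 < fS x y)
    (hKL_int : Integrable (fun x => klDiv (fX x) (fS x)) P) :
    |softAcc P h fX - softAcc P h fS| ≤
      Real.sqrt ((1 / 2) * ∫ x, klDiv (fX x) (fS x) ∂P) := by
  have iX := aux_int P h fX hh_meas hfX_meas hh_nonneg hh_sum hfX_nonneg hfX_sum
  have iS := aux_int P h fS hh_meas hfS_meas hh_nonneg hh_sum hfS_nonneg hfS_sum
  apply Real.abs_le_sqrt
  set m := softAcc P h fX - softAcc P h fS with hm
  have hd : ∫ x, (∑ y, h x y * fX x y - ∑ y, h x y * fS x y) ∂P = m :=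
    integral_sub iX iS
  have key : ∫ x, (4*m*(∑ y, h x y * fX x y - ∑ y, h x y * fS x y) - 2*m^2) ∂P
      ≤ ∫ x, klDiv (fX x) (fS x) ∂P :=
    integral_mono (((iX.sub iS).const_mul (4*m)).sub (integrable_const _)) hKL_int fun x =>
      aux_kl (h x) (fX x) (fS x) m (hh_nonneg x) (hh_sum x) (hfX_nonneg x) (hfX_sum x)
        (hfS_pos x) (hfS_sum x)
  have iD : Integrable (fun x => ∑ y, h x y * fX x y - ∑ y, h x y * fS x y) P := iX.sub iS
  rw [integral_sub (iD.const_mul (4*m)) (integrable_const _),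
    integral_const_mul, integral_const] at key
  simp only [Pi.sub_apply, hd, probReal_univ, one_smul] at key
  nlinarith
end

section
/- Let Z be a measurable space, let Y be a finite nonempty set, let P be a probability measure on Z, let h be a measurable map assigning to each x ∈ Z a PMF h(·|x) on Y, and let f_X and f_S be measurable maps assigning to each x ∈ Z PMFs f_X(·|x) and f_S(·|x) on Y, with f_S(y|x) > 0 for every x ∈ Z and y ∈ Y. Then |acc_P(f_X) − acc_P(f_S)| ≤ E_{x∼P}[ sqrt((1/2) · KL(f_X(·|x) ‖ f_S(·|x))) ]. -/
open MeasureTheory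

lemma pinsker_log_aux (t : ℝ) (ht : 0 < t) :
    5 / 2 - 1 / 4 * t⁻¹ - 27 / 4 * (t + 2)⁻¹ ≤ Real.log t := by
  let φ : ℝ → ℝ := fun t => Real.log t - (5 / 2 - 1 / 4 * t⁻¹ - 27 / 4 * (t + 2)⁻¹)
  have hd : ∀ x : ℝ, 0 < x → HasDerivAt φ ((x - 1) ^ 3 / (x ^ 2 * (x + 2) ^ 2)) x := by
    intro x hx
    have h2 : x + 2 ≠ 0 := by positivity
    have h1 := (hasDerivAt_inv hx.ne').const_mul (1 / 4 : ℝ)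
    have h3 := (((hasDerivAt_id x).add_const (2 : ℝ)).inv h2).const_mul (27 / 4 : ℝ)
    have h4 := (Real.hasDerivAt_log hx.ne').sub ((h1.const_sub (5 / 2)).sub h3)
    refine h4.congr_deriv ?_
    simp only [id]
    field_simp
    ring
  have h1 : φ 1 = 0 := by
    simp only [φ, Real.log_one]; norm_num
  suffices h : φ 1 ≤ φ t by
    rw [h1] at h
    simp only [φ] at h
    linarith
  rcases le_total 1 t with h | h
  · refine monotoneOn_of_deriv_nonneg (convex_Icc 1 t) ?_ ?_ ?_
      (Set.left_mem_Icc.2 h) (Set.right_mem_Icc.2 h) h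
    · intro x hx
      exact (hd x (by linarith [hx.1])).continuousAt.continuousWithinAt
    · intro x hx
      rw [interior_Icc] at hx
      exact (hd x (by linarith [hx.1])).differentiableAt.differentiableWithinAt
    · intro x hx
      rw [interior_Icc] at hx
      rw [(hd x (by linarith [hx.1])).deriv]
      have : 0 ≤ x - 1 := by linarith [hx.1]
      positivity
  · refine antitoneOn_of_deriv_nonpos (convex_Icc t 1) ?_ ?_ ?_
      (Set.left_mem_Icc.2 h) (Set.right_mem_Icc.2 h) h
    · intro x hx
      exact (hd x (by linarith [hx.1])).continuousAt.continuousWithinAt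
    · intro x hx
      rw [interior_Icc] at hx
      exact (hd x (by linarith [hx.1])).differentiableAt.differentiableWithinAt
    · intro x hx
      rw [interior_Icc] at hx
      rw [(hd x (by linarith [hx.1])).deriv]
      have h0 : 0 ≤ 1 - x := by linarith [hx.2]
      have : (x - 1) ^ 3 = - (1 - x) ^ 3 := by ring
      rw [this]
      apply div_nonpos_of_nonpos_of_nonneg
      · have := pow_nonneg h0 3
        linarith
      · positivity

lemma pinsker_term (p q : ℝ) (hp : 0 ≤ p) (hq : 0 < q) :
    (p - q) ^ 2 / ((2 * p + 4 * q) / 3) ≤ p * Real.log (p / q) - p + q := by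
  rcases hp.eq_or_lt with rfl | hp
  · rw [div_le_iff₀ (by positivity)]
    simp
    nlinarith
  · have h := mul_le_mul_of_nonneg_left (pinsker_log_aux (p / q) (by positivity)) hp.le
    have e : p * (5 / 2 - 1 / 4 * (p / q)⁻¹ - 27 / 4 * (p / q + 2)⁻¹) - p + q
        = (p - q) ^ 2 / ((2 * p + 4 * q) / 3) := by
      have : p + 2 * q ≠ 0 := by positivity
      have : p + q * 2 ≠ 0 := by positivity
      have : 2 * p + 4 * q ≠ 0 := by positivity
      have e1 : p / q + 2 = (p + 2 * q) / q := by field_simp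
      have e2 : 2 * p + 4 * q = 2 * (p + 2 * q) := by ring
      rw [e1, e2]
      field_simp
      ring
    linarith

lemma pinsker_fin {Y : Type*} [Fintype Y] (p q : Y → ℝ) (hp : ∀ y, 0 ≤ p y)
    (hq : ∀ y, 0 < q y) (hps : ∑ y, p y = 1) (hqs : ∑ y, q y = 1) :
    (∑ y, |p y - q y|) ^ 2 ≤ 2 * klDiv p q := by
  have hw : ∀ y, 0 < (2 * p y + 4 * q y) / 3 := fun y => by
    have := hp y
    have := hq y
    positivity
  have hs : ∑ y, (2 * p y + 4 * q y) / 3 = 2 := by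
    rw [← Finset.sum_div, Finset.sum_add_distrib, ← Finset.mul_sum, ← Finset.mul_sum, hps, hqs]
    norm_num
  have h1 := Finset.sq_sum_div_le_sum_sq_div Finset.univ (fun y => |p y - q y|)
    (fun y _ => hw y)
  rw [hs, div_le_iff₀ (by norm_num)] at h1
  have h2 : ∑ y, |p y - q y| ^ 2 / ((2 * p y + 4 * q y) / 3) ≤ klDiv p q := by
    have h3 : ∑ y, |p y - q y| ^ 2 / ((2 * p y + 4 * q y) / 3)
        ≤ ∑ y, (p y * Real.log (p y / q y) - p y + q y) :=
      Finset.sum_le_sum fun y _ => by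
        rw [sq_abs]
        exact pinsker_term _ _ (hp y) (hq y)
    rw [Finset.sum_add_distrib, Finset.sum_sub_distrib, hps, hqs, ← klDiv_eq_sum p q hp] at h3
    linarith
  linarith

lemma gap_pointwise {Y : Type*} [Fintype Y] (a p q : Y → ℝ) (ha : ∀ y, 0 ≤ a y)
    (has : ∑ y, a y = 1) (hp : ∀ y, 0 ≤ p y)
    (hq : ∀ y, 0 < q y) (hps : ∑ y, p y = 1) (hqs : ∑ y, q y = 1) :
    |∑ y, a y * p y - ∑ y, a y * q y| ≤ Real.sqrt ((1 / 2) * klDiv p q) := by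
  have ha1 : ∀ y, a y ≤ 1 := fun y => by
    rw [← has]
    exact Finset.single_le_sum (fun i _ => ha i) (Finset.mem_univ y)
  have e : ∑ y, a y * p y - ∑ y, a y * q y = ∑ y, (a y - 1 / 2) * (p y - q y) := by
    have : ∀ y, (a y - 1 / 2) * (p y - q y)
        = a y * p y - a y * q y - (1 / 2 * p y - 1 / 2 * q y) := fun y => by ring
    simp only [this, Finset.sum_sub_distrib, ← Finset.mul_sum, hps, hqs]
    ring
  have hb : |∑ y, a y * p y - ∑ y, a y * q y| ≤ 1 / 2 * ∑ y, |p y - q y| := by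
    rw [e, Finset.mul_sum]
    refine (Finset.abs_sum_le_sum_abs _ _).trans (Finset.sum_le_sum fun y _ => ?_)
    rw [abs_mul]
    refine mul_le_mul_of_nonneg_right ?_ (abs_nonneg _)
    rw [abs_le]
    constructor <;> linarith [ha y, ha1 y]
  refine hb.trans (Real.le_sqrt_of_sq_le ?_)
  have := pinsker_fin p q hp hq hps hqs
  nlinarith

lemma integrable_acc {Z Y : Type*} [MeasurableSpace Z] [Fintype Y]
    (P : Measure Z) [IsProbabilityMeasure P] (h f : Z → Y → ℝ)
    (hh_meas : ∀ y, Measurable fun x => h x y)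
    (hf_meas : ∀ y, Measurable fun x => f x y)
    (hh_nonneg : ∀ x y, 0 ≤ h x y) (hh_sum : ∀ x, ∑ y, h x y = 1)
    (hf_nonneg : ∀ x y, 0 ≤ f x y) (hf_sum : ∀ x, ∑ y, f x y = 1) :
    Integrable (fun x => ∑ y, h x y * f x y) P := by
  refine integrable_finsetSum _ fun y _ => ?_
  refine Integrable.of_bound ((hh_meas y).mul (hf_meas y)).aestronglyMeasurable 1
    (Filter.Eventually.of_forall fun x => ?_)
  have h1 : h x y ≤ 1 := by
    rw [← hh_sum x]
    exact Finset.single_le_sum (fun i _ => hh_nonneg x i) (Finset.mem_univ y)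
  have h2 : f x y ≤ 1 := by
    rw [← hf_sum x]
    exact Finset.single_le_sum (fun i _ => hf_nonneg x i) (Finset.mem_univ y)
  rw [Real.norm_of_nonneg (mul_nonneg (hh_nonneg x y) (hf_nonneg x y))]
  exact mul_le_one₀ h1 (hf_nonneg x y) h2

/-- Pointwise-Pinsker form of the in-domain soft-accuracy gap bound:
`|acc_P(f_X) − acc_P(f_S)| ≤ E_{x∼P}[sqrt((1/2)·KL(f_X(·|x)‖f_S(·|x)))]`. -/
theorem in_domain_accuracy_gap_pointwise_bound
    {Z Y : Type*} [MeasurableSpace Z] [Fintype Y] [Nonempty Y]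
    (P : Measure Z) [IsProbabilityMeasure P]
    (h fX fS : Z → Y → ℝ)
    (hh_meas : ∀ y, Measurable fun x => h x y)
    (hfX_meas : ∀ y, Measurable fun x => fX x y)
    (hfS_meas : ∀ y, Measurable fun x => fS x y)
    (hh_nonneg : ∀ x y, 0 ≤ h x y) (hh_sum : ∀ x, ∑ y, h x y = 1)
    (hfX_nonneg : ∀ x y, 0 ≤ fX x y) (hfX_sum : ∀ x, ∑ y, fX x y = 1)
    (hfS_nonneg : ∀ x y, 0 ≤ fS x y) (hfS_sum : ∀ x, ∑ y, fS x y = 1)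
    (hfS_pos : ∀ x y, 0 < fS x y)
    (hKL_int : Integrable (fun x => klDiv (fX x) (fS x)) P)
    (hsqrtKL_int : Integrable (fun x => Real.sqrt ((1 / 2) * klDiv (fX x) (fS x))) P) :
    |softAcc P h fX - softAcc P h fS| ≤
      ∫ x, Real.sqrt ((1 / 2) * klDiv (fX x) (fS x)) ∂P := by
  unfold softAcc
  rw [← integral_sub
    (integrable_acc P h fX hh_meas hfX_meas hh_nonneg hh_sum hfX_nonneg hfX_sum)
    (integrable_acc P h fS hh_meas hfS_meas hh_nonneg hh_sum hfS_nonneg hfS_sum)]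
  rw [← Real.norm_eq_abs]
  refine norm_integral_le_of_norm_le hsqrtKL_int (Filter.Eventually.of_forall fun x => ?_)
  exact gap_pointwise (h x) (fX x) (fS x) (hh_nonneg x) (hh_sum x) (hfX_nonneg x) (hfS_pos x)
    (hfX_sum x) (hfS_sum x)
end
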